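/- There is no real polynomial P of degree 8 that defines the sign pattern (+,+,+,+,−,+,−,−,+), has no negative real roots, and has exactly four positive real roots, each simple. In other words, the sign pattern (+,+,+,+,−,+,−,−,+) is not realizable with the admissible pair (4,0). -/

import Mathlib

open Polynomial

/-- A degree-8 real polynomial `P` defines the sign pattern `σ = (σ_0, …, σ_8)`
(with entries `1` for `+`, `-1` for `−`) if for each `j` the coefficient of
`x^(8-j)` is nonzero and has sign `σ_j`. -/
def definesSignPattern (P : Polynomial ℝ) (σ : Fin 9 → ℝ) : Prop :=
  ∀ j : Fin 9, Real.sign (P.coeff (8 - (j : ℕ))) = σ j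

/-- A real number of sign `1` is positive. -/
lemma pos_of_real_sign_eq_one {r : ℝ} (h : Real.sign r = 1) : 0 < r := by
  rcases lt_trichotomy r 0 with hr | hr | hr
  · rw [Real.sign_of_neg hr] at h; norm_num at h
  · rw [hr, Real.sign_zero] at h; norm_num at h
  · exact hr

/-- A real number of sign `-1` is negative. -/
lemma neg_of_real_sign_eq_neg_one {r : ℝ} (h : Real.sign r = -1) : r < 0 := by
  rcases lt_trichotomy r 0 with hr | hr | hr
  · exact hr
  · rw [hr, Real.sign_zero] at h; norm_num at h
  · rw [Real.sign_of_pos hr] at h; norm_num at h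

/-- A polynomial of degree 8 with the given signs of coefficients, vanishing at `1` and positive
at `-1`, has at most one root in `(0, 1)`: its quotient by `1 - t ^ 4` is strictly decreasing
there. -/
lemma not_two_roots_of_root_one {a : ℕ → ℝ} (h2 : a 2 < 0) (h3 : 0 < a 3)
    (h5 : 0 < a 5) (h6 : 0 < a 6) (h7 : 0 < a 7) (h8 : 0 < a 8)
    (hone : ∑ i ∈ Finset.range 9, a i * (1 : ℝ) ^ i = 0)
    (hneg : 0 < ∑ i ∈ Finset.range 9, a i * (-1 : ℝ) ^ i)
    {x y : ℝ} (hx : 0 < x) (hxy : x < y) (hy : y < 1)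
    (hPx : ∑ i ∈ Finset.range 9, a i * x ^ i = 0)
    (hPy : ∑ i ∈ Finset.range 9, a i * y ^ i = 0) : False := by
  simp only [Finset.sum_range_succ, Finset.sum_range_zero] at hone hneg hPx hPy
  norm_num at hone hneg
  obtain ⟨s, hs⟩ : ∃ s, s = a 0 + a 2 + a 4 + a 6 + a 8 := ⟨_, rfl⟩
  have hspos : 0 < s := by linarith
  have ha0 : a 0 = s - a 2 - a 4 - a 6 - a 8 := by linarith
  have ha1 : a 1 = -s - a 3 - a 5 - a 7 := by linarith
  obtain ⟨g, hg⟩ : ∃ g : ℝ → ℝ, g = fun t => s * (1 / ((1 + t) * (1 + t ^ 2)))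
      - a 2 * (1 / (1 + t ^ 2)) - a 4 - a 3 * (t / (1 + t ^ 2)) - a 5 * t
      - a 7 * (t ^ 3 + t / (1 + t ^ 2)) - a 6 * (t ^ 2 + 1 / (1 + t ^ 2))
      - a 8 * (1 + t ^ 4) := ⟨_, rfl⟩
  have root : ∀ t : ℝ, 0 < t → t < 1 → a 0 * t ^ 0 + a 1 * t ^ 1 + a 2 * t ^ 2 + a 3 * t ^ 3
      + a 4 * t ^ 4 + a 5 * t ^ 5 + a 6 * t ^ 6 + a 7 * t ^ 7 + a 8 * t ^ 8 = 0 → g t = 0 := by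
    intro t ht0 ht1 h
    have hne : (1 - t ^ 4) ≠ 0 := by
      have : t ^ 4 < 1 := pow_lt_one₀ ht0.le ht1 (by norm_num)
      linarith
    have hmul : (1 - t ^ 4) * g t = 0 := by
      rw [← h, hg, ha0, ha1]
      have : 1 + t ≠ 0 := by positivity
      have : 1 + t ^ 2 ≠ 0 := by positivity
      field_simp
      ring
    exact (mul_eq_zero.mp hmul).resolve_left hne
  have hy0 : 0 < y := hx.trans hxy
  have hx1 : x < 1 := hxy.trans hy
  have gx := root x hx hx1 (by linarith)
  have gy := root y hy0 hy (by linarith)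
  have e2 : x ^ 2 < y ^ 2 := by gcongr
  have e3 : x ^ 3 < y ^ 3 := by gcongr
  have e4 : x ^ 4 < y ^ 4 := by gcongr
  have hxy1 : x * y < 1 := by nlinarith
  have i1 : 1 / ((1 + y) * (1 + y ^ 2)) ≤ 1 / ((1 + x) * (1 + x ^ 2)) := by gcongr
  have i2 : 1 / (1 + y ^ 2) ≤ 1 / (1 + x ^ 2) := by gcongr
  have i3 : x / (1 + x ^ 2) ≤ y / (1 + y ^ 2) := by
    rw [div_le_div_iff₀ (by positivity) (by positivity)]
    nlinarith [mul_pos (sub_pos.2 hxy) (sub_pos.2 hxy1)]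
  have i4 : x ^ 2 + 1 / (1 + x ^ 2) ≤ y ^ 2 + 1 / (1 + y ^ 2) := by
    have : y ^ 2 + 1 / (1 + y ^ 2) - (x ^ 2 + 1 / (1 + x ^ 2))
        = (y ^ 2 - x ^ 2) * (x ^ 2 + y ^ 2 + x ^ 2 * y ^ 2) / ((1 + x ^ 2) * (1 + y ^ 2)) := by
      field_simp
      ring
    have : 0 ≤ (y ^ 2 - x ^ 2) * (x ^ 2 + y ^ 2 + x ^ 2 * y ^ 2)
        / ((1 + x ^ 2) * (1 + y ^ 2)) := by
      have := sub_pos.2 e2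
      positivity
    linarith
  have t1 := mul_le_mul_of_nonneg_left i1 hspos.le
  have t2 := mul_le_mul_of_nonneg_left i2 (neg_pos.2 h2).le
  have t3 := mul_le_mul_of_nonneg_left i3 h3.le
  have t5 := mul_le_mul_of_nonneg_left hxy.le h5.le
  have t7 := mul_le_mul_of_nonneg_left (add_le_add e3.le i3) h7.le
  have t6 := mul_le_mul_of_nonneg_left i4 h6.le
  have t8 := mul_lt_mul_of_pos_left ((add_lt_add_iff_left 1).2 e4) h8
  rw [hg] at gx gy
  simp only at gx gy
  linarith

/-- The given sign pattern is not realizable with the admissible pair (4,0):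
there is no degree 8 real polynomial defining this pattern, with no negative
real roots and exactly four positive real roots, each simple. -/
theorem stmt4 :
    ¬ ∃ P : Polynomial ℝ, P.degree = 8 ∧
      definesSignPattern P ![1, 1, 1, 1, -1, 1, -1, -1, 1] ∧
      (∀ x : ℝ, x < 0 → P.eval x ≠ 0) ∧
      ∃ z : Fin 4 → ℝ, StrictMono z ∧ (∀ i, 0 < z i) ∧
        (∀ i, P.eval (z i) = 0) ∧ (∀ i, P.rootMultiplicity (z i) = 1) ∧
        (∀ x : ℝ, 0 < x → P.eval x = 0 → ∃ i, x = z i) := by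
  rintro ⟨P, hdeg, hsign, hneg, z, hmono, hpos, hroot, -, -⟩
  have h8 : 0 < P.coeff 8 := pos_of_real_sign_eq_one (hsign 0)
  have h7 : 0 < P.coeff 7 := pos_of_real_sign_eq_one (hsign 1)
  have h6 : 0 < P.coeff 6 := pos_of_real_sign_eq_one (hsign 2)
  have h5 : 0 < P.coeff 5 := pos_of_real_sign_eq_one (hsign 3)
  have h3 : 0 < P.coeff 3 := pos_of_real_sign_eq_one (hsign 5)
  have h2 : P.coeff 2 < 0 := neg_of_real_sign_eq_neg_one (hsign 6)
  have h0 : 0 < P.coeff 0 := pos_of_real_sign_eq_one (hsign 8)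
  have hnat : P.natDegree < 9 := by
    rw [natDegree_eq_of_degree_eq_some hdeg]; norm_num
  have hc : 0 < z 3 := hpos 3
  have hP : 0 < P.eval (-z 3) := by
    by_contra! hle
    have h0' : 0 ≤ P.eval 0 := by rw [← coeff_zero_eq_eval_zero]; exact h0.le
    obtain ⟨x, hx, hx0⟩ := intermediate_value_Icc (neg_nonpos.2 hc.le)
      P.continuous.continuousOn ⟨hle, h0'⟩
    rcases hx.2.lt_or_eq with hlt | rfl
    · exact hneg x hlt hx0
    · exact h0.ne' ((coeff_zero_eq_eval_zero P).trans hx0)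
  have heval : ∀ t : ℝ, ∑ i ∈ Finset.range 9, P.coeff i * z 3 ^ i * t ^ i
      = P.eval (z 3 * t) := by
    intro t
    rw [eval_eq_sum_range' hnat]
    exact Finset.sum_congr rfl fun i _ => by rw [mul_pow, mul_assoc]
  have hscale : ∀ j, ∑ i ∈ Finset.range 9, P.coeff i * z 3 ^ i * (z j / z 3) ^ i = 0 := by
    intro j
    rw [heval, mul_div_cancel₀ _ hc.ne', hroot j]
  refine not_two_roots_of_root_one (a := fun i => P.coeff i * z 3 ^ i)
    (mul_neg_of_neg_of_pos h2 (by positivity)) (by positivity)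
    (by positivity) (by positivity) (by positivity)
    (by positivity) ?_ ?_ (div_pos (hpos 0) hc)
    (div_lt_div_of_pos_right (hmono (by decide : (0 : Fin 4) < 1)) hc)
    ((div_lt_one hc).2 (hmono (by decide : (1 : Fin 4) < 3))) (hscale 0) (hscale 1)
  · rw [heval, mul_one, hroot 3]
  · rw [heval, mul_neg_one]; exact hP
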